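/- Consider an L-layer transformer with H heads per layer whose activation σ is L_lip-Lipschitz and all of whose weight matrices (including the unembedding matrix W_unemb ∈ ℝ^{d×d_vocab}) have Frobenius norm at most B, an arbitrary lazy layer set 𝓘 ⊆ {1,…,L}, and discard sets 𝓜_i ⊆ {1,…,i}. For l ∈ 𝓘 let s_l = max_{i∈[N]} (1/H) Σ_{h=1}^H Σ_{j∈𝓜_i} [A_h^{(l)}]_{ij}, where A_h^{(l)} is the causal attention matrix of head h at layer l computed on LN(X^{(l−1)}). Then the logits of the LightTransfer network and of the original transformer satisfy ‖transformer~(X, θ, 𝓘) − transformer(X, θ)‖_{2,∞} ≤ 2L·B²·(H + L_lip·B + 4·H·B²) + 2·H·B²·(1 + L_lip·B²)·Σ_{i∈𝓘} s_i. -/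

import Mathlib

open scoped BigOperators
open Matrix

/-- The Euclidean (ℓ²) norm on `ℝ^d`. -/
noncomputable def l2norm {d : ℕ} (x : Fin d → ℝ) : ℝ := Real.sqrt (∑ i, x i ^ 2)

/-- The ℓ_{2,∞} norm of a matrix: the maximum ℓ² norm of its rows. -/
noncomputable def norm2inf {N d : ℕ} (X : Matrix (Fin N) (Fin d) ℝ) : ℝ :=
  ⨆ i, l2norm (X i)

/-- The Frobenius norm of a matrix. -/
noncomputable def frobNorm {m n : ℕ} (A : Matrix (Fin m) (Fin n) ℝ) : ℝ :=
  Real.sqrt (∑ i, ∑ j, A i j ^ 2)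

/-- The normalization map: `LN x = x` if `‖x‖₂ ≤ 1` and `LN x = x / ‖x‖₂` otherwise. -/
noncomputable def LN {d : ℕ} (x : Fin d → ℝ) : Fin d → ℝ :=
  if l2norm x ≤ 1 then x else (l2norm x)⁻¹ • x

/-- Row-wise application of `LN` to a matrix. -/
noncomputable def matLN {N d : ℕ} (X : Matrix (Fin N) (Fin d) ℝ) :
    Matrix (Fin N) (Fin d) ℝ :=
  Matrix.of fun i => LN (X i)

/-- The causal attention matrix of a single head. -/
noncomputable def causalAttn {N d dk : ℕ} (X : Matrix (Fin N) (Fin d) ℝ)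
    (WQ WK : Matrix (Fin d) (Fin dk) ℝ) : Matrix (Fin N) (Fin N) ℝ :=
  Matrix.of fun i j =>
    if j ≤ i then
      Real.exp ((X * WQ * (X * WK)ᵀ) i j) /
        ∑ k ∈ Finset.univ.filter (fun k : Fin N => k ≤ i),
          Real.exp ((X * WQ * (X * WK)ᵀ) i k)
    else 0

/-- Causal multi-head attention: `mha(X) = ∑_h A_h X W_{V,h}`. -/
noncomputable def mha {N d dk H : ℕ} (X : Matrix (Fin N) (Fin d) ℝ)
    (WQ WK : Fin H → Matrix (Fin d) (Fin dk) ℝ)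
    (WV : Fin H → Matrix (Fin d) (Fin d) ℝ) : Matrix (Fin N) (Fin d) ℝ :=
  ∑ h, causalAttn X (WQ h) (WK h) * X * WV h

/-- The lazy-masked attention matrix of a single head, given discard sets `M i ⊆ {0,…,i}`:
attention of row `i` is restricted to indices `j ≤ i` with `j ∉ M i` and renormalized. -/
noncomputable def lazyAttn {N d dk : ℕ} (X : Matrix (Fin N) (Fin d) ℝ)
    (WQ WK : Matrix (Fin d) (Fin dk) ℝ) (M : Fin N → Finset (Fin N)) :
    Matrix (Fin N) (Fin N) ℝ :=
  Matrix.of fun i j =>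
    if j ≤ i ∧ j ∉ M i then
      Real.exp ((X * WQ * (X * WK)ᵀ) i j) /
        ∑ k ∈ Finset.univ.filter (fun k : Fin N => k ≤ i ∧ k ∉ M i),
          Real.exp ((X * WQ * (X * WK)ᵀ) i k)
    else 0

/-- Lazy-masked causal multi-head attention. -/
noncomputable def lazyMha {N d dk H : ℕ} (X : Matrix (Fin N) (Fin d) ℝ)
    (WQ WK : Fin H → Matrix (Fin d) (Fin dk) ℝ)
    (WV : Fin H → Matrix (Fin d) (Fin d) ℝ) (M : Fin N → Finset (Fin N)) :
    Matrix (Fin N) (Fin d) ℝ :=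
  ∑ h, lazyAttn X (WQ h) (WK h) M * X * WV h

/-- The feed-forward module `ffn(X) = σ(X W₁) W₂`, with `σ` applied entrywise. -/
noncomputable def ffn {N d : ℕ} (σ : ℝ → ℝ) (X : Matrix (Fin N) (Fin d) ℝ)
    (W₁ W₂ : Matrix (Fin d) (Fin d) ℝ) : Matrix (Fin N) (Fin d) ℝ :=
  (X * W₁).map σ * W₂

/-- Hidden states of the original pre-norm transformer: `X⁽⁰⁾ = X` and
`Y⁽ⁱ⁾ = X⁽ⁱ⁻¹⁾ + mha⁽ⁱ⁾(LN(X⁽ⁱ⁻¹⁾))`, `X⁽ⁱ⁾ = Y⁽ⁱ⁾ + ffn⁽ⁱ⁾(LN(Y⁽ⁱ⁾))`,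
where layer `i` uses the weights with index `i`. -/
noncomputable def hiddenStates {N d dk H : ℕ} (σ : ℝ → ℝ)
    (WQ WK : ℕ → Fin H → Matrix (Fin d) (Fin dk) ℝ)
    (WV : ℕ → Fin H → Matrix (Fin d) (Fin d) ℝ)
    (WA1 WA2 : ℕ → Matrix (Fin d) (Fin d) ℝ)
    (X : Matrix (Fin N) (Fin d) ℝ) : ℕ → Matrix (Fin N) (Fin d) ℝ
  | 0 => X
  | i + 1 =>
    let Xp := hiddenStates σ WQ WK WV WA1 WA2 X i
    let Y := Xp + mha (matLN Xp) (WQ (i + 1)) (WK (i + 1)) (WV (i + 1))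
    Y + ffn σ (matLN Y) (WA1 (i + 1)) (WA2 (i + 1))

/-- Hidden states of the LightTransfer network with lazy-layer set `I` and discard sets `M`:
layers in `I` use the lazy-masked attention `mha~` instead of `mha`. -/
noncomputable def ltHiddenStates {N d dk H : ℕ} (σ : ℝ → ℝ)
    (WQ WK : ℕ → Fin H → Matrix (Fin d) (Fin dk) ℝ)
    (WV : ℕ → Fin H → Matrix (Fin d) (Fin d) ℝ)
    (WA1 WA2 : ℕ → Matrix (Fin d) (Fin d) ℝ)
    (I : Finset ℕ) (M : Fin N → Finset (Fin N))
    (X : Matrix (Fin N) (Fin d) ℝ) : ℕ → Matrix (Fin N) (Fin d) ℝ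
  | 0 => X
  | i + 1 =>
    let Xp := ltHiddenStates σ WQ WK WV WA1 WA2 I M X i
    let Y := Xp +
      (if i + 1 ∈ I then lazyMha (matLN Xp) (WQ (i + 1)) (WK (i + 1)) (WV (i + 1)) M
       else mha (matLN Xp) (WQ (i + 1)) (WK (i + 1)) (WV (i + 1)))
    Y + ffn σ (matLN Y) (WA1 (i + 1)) (WA2 (i + 1))

theorem l2norm_eq_norm {d : ℕ} (x : Fin d → ℝ) : l2norm x = ‖WithLp.toLp 2 x‖ := by
  simp [l2norm, EuclideanSpace.norm_eq]

theorem l2norm_nonneg {d : ℕ} (x : Fin d → ℝ) : 0 ≤ l2norm x := Real.sqrt_nonneg _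

theorem l2norm_sq {d : ℕ} (x : Fin d → ℝ) : l2norm x ^ 2 = ∑ i, x i ^ 2 :=
  Real.sq_sqrt (Finset.sum_nonneg fun _ _ => sq_nonneg _)

theorem l2norm_add_le {d : ℕ} (x y : Fin d → ℝ) : l2norm (x + y) ≤ l2norm x + l2norm y := by
  simpa only [l2norm_eq_norm, WithLp.toLp_add] using norm_add_le _ _

theorem l2norm_sub_le {d : ℕ} (x y : Fin d → ℝ) : l2norm (x - y) ≤ l2norm x + l2norm y := by
  simpa only [l2norm_eq_norm, WithLp.toLp_sub] using norm_sub_le _ _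

theorem l2norm_smul {d : ℕ} (c : ℝ) (x : Fin d → ℝ) : l2norm (c • x) = |c| * l2norm x := by
  simp only [l2norm_eq_norm, WithLp.toLp_smul, norm_smul, Real.norm_eq_abs]

theorem l2norm_sum_le {d : ℕ} {ι : Type*} (t : Finset ι) (f : ι → Fin d → ℝ) :
    l2norm (∑ i ∈ t, f i) ≤ ∑ i ∈ t, l2norm (f i) := by
  simpa only [l2norm_eq_norm, WithLp.toLp_sum] using norm_sum_le _ _

theorem abs_dotProduct_le {d : ℕ} (x y : Fin d → ℝ) :
    |x ⬝ᵥ y| ≤ l2norm x * l2norm y := by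
  refine abs_le_of_sq_le_sq ?_ (mul_nonneg (l2norm_nonneg _) (l2norm_nonneg _))
  rw [mul_pow, l2norm_sq, l2norm_sq]
  exact Finset.sum_mul_sq_le_sq_mul_sq _ _ _

theorem l2norm_vecMul_le {m n : ℕ} (x : Fin m → ℝ) (W : Matrix (Fin m) (Fin n) ℝ) :
    l2norm (x ᵥ* W) ≤ l2norm x * frobNorm W := by
  have hW : frobNorm W ^ 2 = ∑ j, ∑ i, W i j ^ 2 := by
    rw [frobNorm, Real.sq_sqrt (by positivity), Finset.sum_comm]
  have hW0 : 0 ≤ frobNorm W := Real.sqrt_nonneg _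
  refine abs_le_of_sq_le_sq' ?_ (mul_nonneg (l2norm_nonneg x) hW0) |>.2
  rw [mul_pow, hW, l2norm_sq, l2norm_sq, Finset.mul_sum]
  exact Finset.sum_le_sum fun j _ => Finset.sum_mul_sq_le_sq_mul_sq Finset.univ x fun i => W i j

theorem l2norm_LN_le {d : ℕ} (x : Fin d → ℝ) : l2norm (LN x) ≤ 1 := by
  unfold LN
  split_ifs with h
  · exact h
  · push Not at h
    rw [l2norm_smul, abs_of_pos (by positivity), inv_mul_cancel₀ (by positivity)]

/-- The softmax of `z` restricted to the index set `S`, extended by zero. -/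
noncomputable def softmaxOn {ι : Type*} [DecidableEq ι] (S : Finset ι) (z : ι → ℝ) (j : ι) : ℝ :=
  if j ∈ S then Real.exp (z j) / ∑ k ∈ S, Real.exp (z k) else 0

section softmaxOn

variable {ι : Type*} [DecidableEq ι]

theorem softmaxOn_nonneg (S : Finset ι) (z : ι → ℝ) (j : ι) : 0 ≤ softmaxOn S z j := by
  unfold softmaxOn
  split_ifs <;> positivity

theorem sum_softmaxOn [Fintype ι] {S : Finset ι} (hS : S.Nonempty) (z : ι → ℝ) :
    ∑ j, softmaxOn S z j = 1 := by
  have : 0 < ∑ k ∈ S, Real.exp (z k) := Finset.sum_pos (fun _ _ => Real.exp_pos _) hS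
  simp only [softmaxOn, Finset.sum_ite_mem, Finset.univ_inter]
  rw [← Finset.sum_div, div_self this.ne']

theorem sum_softmaxOn_le_one [Fintype ι] (S : Finset ι) (z : ι → ℝ) :
    ∑ j, softmaxOn S z j ≤ 1 := by
  rcases S.eq_empty_or_nonempty with rfl | hS
  · simp [softmaxOn]
  · exact (sum_softmaxOn hS z).le

theorem softmaxOn_sub_le {b : ℝ} {S : Finset ι} {z w : ι → ℝ} (hz : ∀ j ∈ S, |z j| ≤ b)
    (hw : ∀ j ∈ S, |w j| ≤ b) (j : ι) :
    softmaxOn S z j - softmaxOn S w j ≤ 4 * b * softmaxOn S z j := by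
  unfold softmaxOn
  split_ifs with hj
  · have hlip : ∀ k ∈ S, |z k - w k| ≤ 2 * b := fun k hk => by
      linarith [abs_sub (z k) (w k), hz k hk, hw k hk]
    have hZ : 0 < ∑ k ∈ S, Real.exp (z k) := Finset.sum_pos (fun _ _ => Real.exp_pos _) ⟨j, hj⟩
    have hW : 0 < ∑ k ∈ S, Real.exp (w k) := Finset.sum_pos (fun _ _ => Real.exp_pos _) ⟨j, hj⟩
    have hsum : ∑ k ∈ S, Real.exp (w k) ≤ Real.exp (2 * b) * ∑ k ∈ S, Real.exp (z k) := by
      rw [Finset.mul_sum]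
      refine Finset.sum_le_sum fun k hk => ?_
      rw [← Real.exp_add, Real.exp_le_exp]
      linarith [(abs_le.1 (hlip k hk)).1]
    have hnum : Real.exp (-(2 * b)) * Real.exp (z j) ≤ Real.exp (w j) := by
      rw [← Real.exp_add, Real.exp_le_exp]
      linarith [(abs_le.1 (hlip j hj)).2]
    have key : Real.exp (-(4 * b)) * (Real.exp (z j) / ∑ k ∈ S, Real.exp (z k)) ≤
        Real.exp (w j) / ∑ k ∈ S, Real.exp (w k) := by
      calc _ = Real.exp (-(2 * b)) * Real.exp (z j) /
              (Real.exp (2 * b) * ∑ k ∈ S, Real.exp (z k)) := by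
            rw [show -(4 * b) = -(2 * b) + -(2 * b) by ring, Real.exp_add, Real.exp_neg (2 * b)]
            field_simp
        _ ≤ _ := div_le_div₀ (Real.exp_pos _).le hnum hW hsum
    have hp : 0 ≤ Real.exp (z j) / ∑ k ∈ S, Real.exp (z k) := by positivity
    nlinarith [Real.add_one_le_exp (-(4 * b))]
  · simp

theorem sum_abs_softmaxOn_sub_le [Fintype ι] {b : ℝ} (hb : 0 ≤ b) {S : Finset ι} {z w : ι → ℝ}
    (hz : ∀ j ∈ S, |z j| ≤ b) (hw : ∀ j ∈ S, |w j| ≤ b) :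
    ∑ j, |softmaxOn S z j - softmaxOn S w j| ≤ 8 * b := by
  calc ∑ j, |softmaxOn S z j - softmaxOn S w j|
      ≤ ∑ j, 4 * b * (softmaxOn S z j + softmaxOn S w j) := by
        refine Finset.sum_le_sum fun j _ => abs_le.2 ⟨?_, ?_⟩
        · nlinarith [softmaxOn_sub_le hw hz j, mul_nonneg hb (softmaxOn_nonneg S z j)]
        · nlinarith [softmaxOn_sub_le hz hw j, mul_nonneg hb (softmaxOn_nonneg S w j)]
    _ = 4 * b * (∑ j, softmaxOn S z j + ∑ j, softmaxOn S w j) := by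
        rw [← Finset.mul_sum, Finset.sum_add_distrib]
    _ ≤ 4 * b * (1 + 1) := by
        gcongr <;> exact sum_softmaxOn_le_one _ _
    _ = 8 * b := by ring

/-- Discarding the indices in `S \ T` and renormalizing moves twice the discarded mass. -/
theorem sum_abs_softmaxOn_sub_softmaxOn_le [Fintype ι] {S T : Finset ι} (hTS : T ⊆ S)
    (z : ι → ℝ) :
    ∑ j, |softmaxOn T z j - softmaxOn S z j| ≤ 2 * ∑ j ∈ S \ T, softmaxOn S z j := by
  rcases S.eq_empty_or_nonempty with rfl | hS
  · obtain rfl := Finset.subset_empty.1 hTS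
    simp
  have hsplit : ∀ f : ι → ℝ, (∀ j ∉ S, f j = 0) → ∑ j, f j = ∑ j ∈ S \ T, f j + ∑ j ∈ T, f j := by
    intro f hf
    rw [Finset.sum_sdiff hTS]
    exact (Finset.sum_subset (Finset.subset_univ S) fun j _ hj => hf j hj).symm
  have hS0 : ∀ j ∉ S, softmaxOn S z j = 0 := fun j hj => if_neg hj
  have hT0 : ∀ j ∉ T, softmaxOn T z j = 0 := fun j hj => if_neg hj
  have hdisc : ∑ j ∈ S \ T, |softmaxOn T z j - softmaxOn S z j| =
      ∑ j ∈ S \ T, softmaxOn S z j := by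
    refine Finset.sum_congr rfl fun j hj => ?_
    rw [hT0 j (Finset.mem_sdiff.1 hj).2, zero_sub, abs_neg,
      abs_of_nonneg (softmaxOn_nonneg _ _ _)]
  rw [hsplit (fun j => |softmaxOn T z j - softmaxOn S z j|)
    (fun j hj => by simp [hS0 j hj, hT0 j fun h => hj (hTS h)]), hdisc, two_mul]
  gcongr
  rcases T.eq_empty_or_nonempty with rfl | hT
  · simpa using Finset.sum_nonneg fun j (_ : j ∈ S) => softmaxOn_nonneg S z j
  have hmono : ∀ j ∈ T, softmaxOn S z j ≤ softmaxOn T z j := by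
    intro j hj
    have : 0 < ∑ k ∈ T, Real.exp (z k) := Finset.sum_pos (fun _ _ => Real.exp_pos _) hT
    rw [softmaxOn, softmaxOn, if_pos hj, if_pos (hTS hj)]
    exact div_le_div_of_nonneg_left (Real.exp_pos _).le this
      (Finset.sum_le_sum_of_subset_of_nonneg hTS fun _ _ _ => (Real.exp_pos _).le)
  have hmassS := hsplit _ hS0
  have hmassT := hsplit _ fun j hj => hT0 j fun h => hj (hTS h)
  rw [sum_softmaxOn hS] at hmassS
  rw [sum_softmaxOn hT, Finset.sum_eq_zero fun j hj => hT0 j (Finset.mem_sdiff.1 hj).2]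
    at hmassT
  rw [Finset.sum_congr rfl fun j hj => abs_of_nonneg (sub_nonneg.2 (hmono j hj)),
    Finset.sum_sub_distrib]
  linarith

end softmaxOn

/-- The attention scores of one head. -/
noncomputable def attnScore {N d dk : ℕ} (X : Matrix (Fin N) (Fin d) ℝ)
    (WQ WK : Matrix (Fin d) (Fin dk) ℝ) : Matrix (Fin N) (Fin N) ℝ :=
  X * WQ * (X * WK)ᵀ

theorem causalAttn_apply {N d dk : ℕ} (X : Matrix (Fin N) (Fin d) ℝ)
    (WQ WK : Matrix (Fin d) (Fin dk) ℝ) (i j : Fin N) :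
    causalAttn X WQ WK i j =
      softmaxOn (Finset.univ.filter (· ≤ i)) (attnScore X WQ WK i) j := by
  simp [causalAttn, softmaxOn, attnScore]

theorem lazyAttn_apply {N d dk : ℕ} (X : Matrix (Fin N) (Fin d) ℝ)
    (WQ WK : Matrix (Fin d) (Fin dk) ℝ) (M : Fin N → Finset (Fin N)) (i j : Fin N) :
    lazyAttn X WQ WK M i j =
      softmaxOn (Finset.univ.filter fun k => k ≤ i ∧ k ∉ M i) (attnScore X WQ WK i) j := by
  simp [lazyAttn, softmaxOn, attnScore]

theorem mul_row {l m n : ℕ} (A : Matrix (Fin l) (Fin m) ℝ) (W : Matrix (Fin m) (Fin n) ℝ)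
    (i : Fin l) : (A * W) i = A i ᵥ* W := rfl

theorem sum_row {m n : ℕ} {ι : Type*} (t : Finset ι) (f : ι → Matrix (Fin m) (Fin n) ℝ)
    (i : Fin m) : (∑ h ∈ t, f h) i = ∑ h ∈ t, f h i := by
  funext j
  rw [Matrix.sum_apply, Finset.sum_apply]

theorem abs_attnScore_le {N d dk : ℕ} {B : ℝ} {X : Matrix (Fin N) (Fin d) ℝ}
    {WQ WK : Matrix (Fin d) (Fin dk) ℝ} (hX : ∀ i, l2norm (X i) ≤ 1) (hQ : frobNorm WQ ≤ B)
    (hK : frobNorm WK ≤ B) (i j : Fin N) : |attnScore X WQ WK i j| ≤ B ^ 2 := by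
  have hB : 0 ≤ B := (Real.sqrt_nonneg _).trans hQ
  have hrow : ∀ {W : Matrix (Fin d) (Fin dk) ℝ}, frobNorm W ≤ B → ∀ i, l2norm ((X * W) i) ≤ B :=
    fun {W} hW i => (l2norm_vecMul_le (X i) W).trans <|
      (mul_le_mul (hX i) hW (Real.sqrt_nonneg _) zero_le_one).trans_eq (one_mul B)
  calc |attnScore X WQ WK i j| ≤ l2norm ((X * WQ) i) * l2norm ((X * WK) j) :=
        abs_dotProduct_le _ _
    _ ≤ B * B := mul_le_mul (hrow hQ i) (hrow hK j) (l2norm_nonneg _) hB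
    _ = B ^ 2 := (sq B).symm

theorem l2norm_vecMul_le_sum_abs {N d : ℕ} {c : ℝ} (a : Fin N → ℝ) {X : Matrix (Fin N) (Fin d) ℝ}
    (hX : ∀ i, l2norm (X i) ≤ c) : l2norm (a ᵥ* X) ≤ (∑ j, |a j|) * c := by
  rw [Matrix.vecMul_eq_sum, Finset.sum_mul]
  refine (l2norm_sum_le _ _).trans (Finset.sum_le_sum fun j _ => ?_)
  rw [l2norm_smul]
  exact mul_le_mul_of_nonneg_left (hX j) (abs_nonneg _)

/-- The output of one softmax head over a fixed index set moves by a bounded amount. -/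
theorem l2norm_softmaxOn_vecMul_sub_le {N d dk : ℕ} {B : ℝ} {X X' : Matrix (Fin N) (Fin d) ℝ}
    {WQ WK : Matrix (Fin d) (Fin dk) ℝ} (hX : ∀ i, l2norm (X i) ≤ 1)
    (hX' : ∀ i, l2norm (X' i) ≤ 1) (hQ : frobNorm WQ ≤ B) (hK : frobNorm WK ≤ B)
    (S : Finset (Fin N)) (i : Fin N) :
    l2norm (softmaxOn S (attnScore X' WQ WK i) ᵥ* X' - softmaxOn S (attnScore X WQ WK i) ᵥ* X) ≤
      2 + 8 * B ^ 2 := by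
  set p := softmaxOn S (attnScore X' WQ WK i)
  set q := softmaxOn S (attnScore X WQ WK i)
  have hsplit : p ᵥ* X' - q ᵥ* X = p ᵥ* (X' - X) + (p - q) ᵥ* X := by
    rw [Matrix.vecMul_sub, Matrix.sub_vecMul]; abel
  have h1 : ∑ j, |p j| ≤ 1 := by
    rw [Finset.sum_congr rfl fun j _ => abs_of_nonneg (softmaxOn_nonneg _ _ j)]
    exact sum_softmaxOn_le_one _ _
  have h2 : ∑ j, |(p - q) j| ≤ 8 * B ^ 2 :=
    sum_abs_softmaxOn_sub_le (sq_nonneg B) (fun j _ => abs_attnScore_le hX' hQ hK i j)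
      fun j _ => abs_attnScore_le hX hQ hK i j
  have hd : ∀ j, l2norm ((X' - X) j) ≤ 2 := fun j =>
    (l2norm_sub_le (X' j) (X j)).trans (by linarith [hX j, hX' j])
  rw [hsplit]
  refine (l2norm_add_le _ _).trans ?_
  linarith [l2norm_vecMul_le_sum_abs p hd, l2norm_vecMul_le_sum_abs (p - q) hX]

theorem l2norm_sum_vecMul_sub_le {m n H : ℕ} {B : ℝ} {W : Fin H → Matrix (Fin m) (Fin n) ℝ}
    (hW : ∀ h, frobNorm (W h) ≤ B) {u v : Fin H → Fin m → ℝ} {c : Fin H → ℝ}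
    (huv : ∀ h, l2norm (u h - v h) ≤ c h) :
    l2norm (∑ h, u h ᵥ* W h - ∑ h, v h ᵥ* W h) ≤ B * ∑ h, c h := by
  rw [← Finset.sum_sub_distrib, Finset.mul_sum]
  refine (l2norm_sum_le _ _).trans (Finset.sum_le_sum fun h _ => ?_)
  rw [← Matrix.sub_vecMul, mul_comm B]
  exact (l2norm_vecMul_le _ _).trans (mul_le_mul (huv h) (hW h) (Real.sqrt_nonneg _)
    ((l2norm_nonneg _).trans (huv h)))

theorem mha_row {N d dk H : ℕ} (X : Matrix (Fin N) (Fin d) ℝ)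
    (WQ WK : Fin H → Matrix (Fin d) (Fin dk) ℝ) (WV : Fin H → Matrix (Fin d) (Fin d) ℝ)
    (i : Fin N) :
    mha X WQ WK WV i = ∑ h,
      (softmaxOn (Finset.univ.filter (· ≤ i)) (attnScore X (WQ h) (WK h) i) ᵥ* X) ᵥ* WV h := by
  rw [mha, sum_row]
  refine Finset.sum_congr rfl fun h _ => ?_
  rw [mul_row, mul_row]
  congr 2
  exact funext fun j => causalAttn_apply _ _ _ _ _

theorem lazyMha_row {N d dk H : ℕ} (X : Matrix (Fin N) (Fin d) ℝ)
    (WQ WK : Fin H → Matrix (Fin d) (Fin dk) ℝ) (WV : Fin H → Matrix (Fin d) (Fin d) ℝ)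
    (M : Fin N → Finset (Fin N)) (i : Fin N) :
    lazyMha X WQ WK WV M i = ∑ h,
      (softmaxOn (Finset.univ.filter fun k => k ≤ i ∧ k ∉ M i)
        (attnScore X (WQ h) (WK h) i) ᵥ* X) ᵥ* WV h := by
  rw [lazyMha, sum_row]
  refine Finset.sum_congr rfl fun h _ => ?_
  rw [mul_row, mul_row]
  congr 2
  exact funext fun j => lazyAttn_apply _ _ _ _ _ _

section layers

variable {N d dk H : ℕ} {B : ℝ} {X X' : Matrix (Fin N) (Fin d) ℝ}
  {WQ WK : Fin H → Matrix (Fin d) (Fin dk) ℝ} {WV : Fin H → Matrix (Fin d) (Fin d) ℝ}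

theorem l2norm_mha_sub_le (hX : ∀ i, l2norm (X i) ≤ 1) (hX' : ∀ i, l2norm (X' i) ≤ 1)
    (hQ : ∀ h, frobNorm (WQ h) ≤ B) (hK : ∀ h, frobNorm (WK h) ≤ B)
    (hV : ∀ h, frobNorm (WV h) ≤ B) (i : Fin N) :
    l2norm (mha X' WQ WK WV i - mha X WQ WK WV i) ≤ H * B * (2 + 8 * B ^ 2) := by
  rw [mha_row, mha_row]
  refine (l2norm_sum_vecMul_sub_le hV fun h =>
    l2norm_softmaxOn_vecMul_sub_le hX hX' (hQ h) (hK h) _ i).trans_eq ?_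
  simp; ring

theorem l2norm_lazyMha_sub_mha_le (hX : ∀ i, l2norm (X i) ≤ 1) (hX' : ∀ i, l2norm (X' i) ≤ 1)
    (hQ : ∀ h, frobNorm (WQ h) ≤ B) (hK : ∀ h, frobNorm (WK h) ≤ B)
    (hV : ∀ h, frobNorm (WV h) ≤ B) {M : Fin N → Finset (Fin N)}
    (hM : ∀ i : Fin N, ∀ j ∈ M i, j ≤ i) (i : Fin N) :
    l2norm (lazyMha X' WQ WK WV M i - mha X WQ WK WV i) ≤
      H * B * (2 + 8 * B ^ 2) + 2 * B * ∑ h, ∑ j ∈ M i, causalAttn X (WQ h) (WK h) i j := by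
  rw [lazyMha_row, mha_row]
  set T : Finset (Fin N) := Finset.univ.filter fun k => k ≤ i ∧ k ∉ M i
  set S : Finset (Fin N) := Finset.univ.filter (· ≤ i)
  have hTS : T ⊆ S := fun k hk => by
    simp only [T, S, Finset.mem_filter] at hk ⊢
    exact ⟨hk.1, hk.2.1⟩
  have hdiff : S \ T = M i := by
    ext k
    simp only [S, T, Finset.mem_sdiff, Finset.mem_filter, Finset.mem_univ, true_and]
    constructor
    · tauto
    · exact fun hk => ⟨hM i k hk, fun h => h.2 hk⟩
  refine (l2norm_sum_vecMul_sub_le hV (c := fun h => (2 + 8 * B ^ 2) +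
    2 * ∑ j ∈ M i, causalAttn X (WQ h) (WK h) i j) fun h => ?_).trans_eq ?_
  · have hdrop : l2norm ((softmaxOn T (attnScore X (WQ h) (WK h) i) -
        softmaxOn S (attnScore X (WQ h) (WK h) i)) ᵥ* X) ≤
        2 * ∑ j ∈ M i, causalAttn X (WQ h) (WK h) i j := by
      refine (l2norm_vecMul_le_sum_abs _ hX).trans ?_
      rw [mul_one, ← hdiff, Finset.sum_congr rfl fun j _ => causalAttn_apply X (WQ h) (WK h) i j]
      exact sum_abs_softmaxOn_sub_softmaxOn_le hTS _
    rw [Matrix.sub_vecMul] at hdrop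
    rw [← sub_add_sub_cancel _ (softmaxOn T (attnScore X (WQ h) (WK h) i) ᵥ* X)]
    exact (l2norm_add_le _ _).trans
      (add_le_add (l2norm_softmaxOn_vecMul_sub_le hX hX' (hQ h) (hK h) T i) hdrop)
  · rw [Finset.sum_add_distrib, ← Finset.mul_sum]
    simp; ring

theorem l2norm_ffn_sub_le {K : ℝ} {σ : ℝ → ℝ} (hK : 0 ≤ K)
    (hσ : ∀ x y : ℝ, |σ x - σ y| ≤ K * |x - y|) (hX : ∀ i, l2norm (X i) ≤ 1)
    (hX' : ∀ i, l2norm (X' i) ≤ 1) {W₁ W₂ : Matrix (Fin d) (Fin d) ℝ} (hW₁ : frobNorm W₁ ≤ B)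
    (hW₂ : frobNorm W₂ ≤ B) (i : Fin N) :
    l2norm (ffn σ X' W₁ W₂ i - ffn σ X W₁ W₂ i) ≤ 2 * K * B ^ 2 := by
  have hB : 0 ≤ B := (Real.sqrt_nonneg _).trans hW₁
  have hlip : ∀ u v : Fin d → ℝ, l2norm (σ ∘ u - σ ∘ v) ≤ K * l2norm (u - v) := by
    intro u v
    refine abs_le_of_sq_le_sq' ?_ (mul_nonneg hK (l2norm_nonneg _)) |>.2
    rw [mul_pow, l2norm_sq, l2norm_sq, Finset.mul_sum]
    refine Finset.sum_le_sum fun j _ => ?_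
    rw [← mul_pow]
    refine sq_le_sq.2 ((hσ (u j) (v j)).trans_eq ?_)
    rw [abs_mul, abs_of_nonneg hK, Pi.sub_apply]
  have hd : l2norm (X' i - X i) ≤ 2 :=
    (l2norm_sub_le _ _).trans (by linarith [hX i, hX' i])
  have hin : l2norm (X' i ᵥ* W₁ - X i ᵥ* W₁) ≤ 2 * B := by
    rw [← Matrix.sub_vecMul]
    exact (l2norm_vecMul_le _ _).trans (mul_le_mul hd hW₁ (Real.sqrt_nonneg _) zero_le_two)
  have hrow : ffn σ X' W₁ W₂ i - ffn σ X W₁ W₂ i =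
      (σ ∘ (X' i ᵥ* W₁) - σ ∘ (X i ᵥ* W₁)) ᵥ* W₂ := by
    rw [Matrix.sub_vecMul]; rfl
  rw [hrow]
  calc _ ≤ _ := l2norm_vecMul_le _ _
    _ ≤ K * (2 * B) * B := mul_le_mul ((hlip _ _).trans (mul_le_mul_of_nonneg_left hin hK)) hW₂
        (Real.sqrt_nonneg _) (by positivity)
    _ = 2 * K * B ^ 2 := by ring

end layers

/-- Logit error bound of Theorem 2 (Eqn. (logit)):
`‖transformer~(X, θ, 𝓘) − transformer(X, θ)‖_{2,∞}
   ≤ 2LB²(H + L_lip B + 4HB²) + 2HB²(1 + L_lip B²) ∑_{i∈𝓘} sᵢ`,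
where the logits are the final hidden states multiplied by the unembedding matrix. -/
theorem lighttransfer_logit_error {L H N d dk dvocab : ℕ} (B L_lip : ℝ)
    (hB : 0 < B) (hL_lip : 0 < L_lip)
    (σ : ℝ → ℝ) (hσ : ∀ x y : ℝ, |σ x - σ y| ≤ L_lip * |x - y|)
    (WQ WK : ℕ → Fin H → Matrix (Fin d) (Fin dk) ℝ)
    (WV : ℕ → Fin H → Matrix (Fin d) (Fin d) ℝ)
    (WA1 WA2 : ℕ → Matrix (Fin d) (Fin d) ℝ)
    (Wunemb : Matrix (Fin d) (Fin dvocab) ℝ)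
    (hWQ : ∀ l, 1 ≤ l → l ≤ L → ∀ h, frobNorm (WQ l h) ≤ B)
    (hWK : ∀ l, 1 ≤ l → l ≤ L → ∀ h, frobNorm (WK l h) ≤ B)
    (hWV : ∀ l, 1 ≤ l → l ≤ L → ∀ h, frobNorm (WV l h) ≤ B)
    (hWA1 : ∀ l, 1 ≤ l → l ≤ L → frobNorm (WA1 l) ≤ B)
    (hWA2 : ∀ l, 1 ≤ l → l ≤ L → frobNorm (WA2 l) ≤ B)
    (hWunemb : frobNorm Wunemb ≤ B)
    (I : Finset ℕ) (hI : I ⊆ Finset.Icc 1 L)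
    (M : Fin N → Finset (Fin N)) (hM : ∀ i : Fin N, ∀ j ∈ M i, j ≤ i)
    (X : Matrix (Fin N) (Fin d) ℝ)
    (s : ℕ → ℝ)
    (hs : ∀ l, s l = ⨆ i : Fin N, (1 / (H : ℝ)) * ∑ h, ∑ j ∈ M i,
        causalAttn (matLN (hiddenStates σ WQ WK WV WA1 WA2 X (l - 1)))
          (WQ l h) (WK l h) i j) :
    norm2inf (ltHiddenStates σ WQ WK WV WA1 WA2 I M X L * Wunemb -
        hiddenStates σ WQ WK WV WA1 WA2 X L * Wunemb) ≤
      2 * L * B ^ 2 * (H + L_lip * B + 4 * H * B ^ 2)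
        + 2 * H * B ^ 2 * (1 + L_lip * B ^ 2) * ∑ i ∈ I, s i := by
  have hs0 : ∀ l, 0 ≤ s l := fun l => by
    rw [hs]
    refine Real.iSup_nonneg fun i => mul_nonneg (by positivity)
      (Finset.sum_nonneg fun h _ => Finset.sum_nonneg fun j _ => ?_)
    rw [causalAttn_apply]
    exact softmaxOn_nonneg _ _ _
  have hmass : ∀ l (i : Fin N), ∑ h, ∑ j ∈ M i,
      causalAttn (matLN (hiddenStates σ WQ WK WV WA1 WA2 X l))
        (WQ (l + 1) h) (WK (l + 1) h) i j ≤ H * s (l + 1) := by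
    intro l i
    rcases Nat.eq_zero_or_pos H with rfl | hH
    · simp
    have hH' : (0 : ℝ) < H := by exact_mod_cast hH
    rw [← div_le_iff₀' hH', hs (l + 1), div_eq_inv_mul, ← one_div]
    exact le_ciSup (f := fun i : Fin N => (1 / (H : ℝ)) * ∑ h, ∑ j ∈ M i,
        causalAttn (matLN (hiddenStates σ WQ WK WV WA1 WA2 X l))
          (WQ (l + 1) h) (WK (l + 1) h) i j) (Set.finite_range _).bddAbove i
  have hLN : ∀ (Z : Matrix (Fin N) (Fin d) ℝ) (i : Fin N), l2norm (matLN Z i) ≤ 1 :=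
    fun Z i => l2norm_LN_le _
  have hstep : ∀ l ≤ L, ∀ i, l2norm (ltHiddenStates σ WQ WK WV WA1 WA2 I M X l i -
      hiddenStates σ WQ WK WV WA1 WA2 X l i) ≤
      ∑ k ∈ Finset.range l, (H * B * (2 + 8 * B ^ 2) + 2 * L_lip * B ^ 2 +
        if k + 1 ∈ I then 2 * H * B * s (k + 1) else 0) := by
    intro l
    induction l with
    | zero => intro _ i; simp [ltHiddenStates, hiddenStates, l2norm]
    | succ l ih =>
      intro hl i
      have hprev := ih (by omega) i
      have hQ := hWQ (l + 1) (by omega) hl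
      have hK := hWK (l + 1) (by omega) hl
      have hV := hWV (l + 1) (by omega) hl
      rw [Finset.sum_range_succ]
      simp only [ltHiddenStates, hiddenStates]
      set Xt := ltHiddenStates σ WQ WK WV WA1 WA2 I M X l
      set Xo := hiddenStates σ WQ WK WV WA1 WA2 X l
      set At := if l + 1 ∈ I then
        lazyMha (matLN Xt) (WQ (l + 1)) (WK (l + 1)) (WV (l + 1)) M
        else mha (matLN Xt) (WQ (l + 1)) (WK (l + 1)) (WV (l + 1)) with hAt
      set Ao := mha (matLN Xo) (WQ (l + 1)) (WK (l + 1)) (WV (l + 1))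
      have hattn : l2norm (At i - Ao i) ≤ H * B * (2 + 8 * B ^ 2) +
          if l + 1 ∈ I then 2 * H * B * s (l + 1) else 0 := by
        rw [hAt]
        split_ifs with hmem
        · have hlazy := l2norm_lazyMha_sub_mha_le (hLN Xo) (hLN Xt) hQ hK hV hM i
          nlinarith [hmass l i]
        · rw [add_zero]
          exact l2norm_mha_sub_le (hLN Xo) (hLN Xt) hQ hK hV i
      have hffn := l2norm_ffn_sub_le hL_lip.le hσ (hLN (Xo + Ao)) (hLN (Xt + At))
        (hWA1 (l + 1) (by omega) hl) (hWA2 (l + 1) (by omega) hl) i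
      set Ft := ffn σ (matLN (Xt + At)) (WA1 (l + 1)) (WA2 (l + 1))
      set Fo := ffn σ (matLN (Xo + Ao)) (WA1 (l + 1)) (WA2 (l + 1))
      have hdecomp : (Xt + At + Ft) i - (Xo + Ao + Fo) i =
          (Xt i - Xo i) + (At i - Ao i) + (Ft i - Fo i) := by
        funext j
        simp only [Matrix.add_apply, Pi.sub_apply, Pi.add_apply]
        ring
      rw [hdecomp]
      linarith [l2norm_add_le ((Xt i - Xo i) + (At i - Ao i)) (Ft i - Fo i),
        l2norm_add_le (Xt i - Xo i) (At i - Ao i)]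
  have hsumI : ∑ k ∈ Finset.range L, (if k + 1 ∈ I then 2 * H * B * s (k + 1) else 0) =
      2 * H * B * ∑ l ∈ I, s l := by
    rw [Finset.range_eq_Ico,
      Finset.sum_Ico_add' (fun l => if l ∈ I then 2 * H * B * s l else 0) 0 L 1,
      Finset.sum_ite_mem, Finset.mul_sum]
    refine Finset.sum_congr (Finset.inter_eq_right.2 fun l hl => ?_) fun _ _ => rfl
    have := Finset.mem_Icc.1 (hI hl)
    exact Finset.mem_Ico.2 ⟨by omega, by omega⟩
  have hsI : 0 ≤ ∑ l ∈ I, s l := Finset.sum_nonneg fun l _ => hs0 l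
  refine Real.iSup_le (fun i => ?_) (by positivity)
  have hfinal := hstep L le_rfl i
  rw [Finset.sum_add_distrib, hsumI, Finset.sum_const, Finset.card_range, nsmul_eq_mul] at hfinal
  have hextra : 0 ≤ H * B ^ 2 * (L_lip * B ^ 2) * ∑ l ∈ I, s l := by positivity
  have hrow : (ltHiddenStates σ WQ WK WV WA1 WA2 I M X L * Wunemb -
      hiddenStates σ WQ WK WV WA1 WA2 X L * Wunemb) i =
      (ltHiddenStates σ WQ WK WV WA1 WA2 I M X L i -
        hiddenStates σ WQ WK WV WA1 WA2 X L i) ᵥ* Wunemb := by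
    rw [Matrix.sub_vecMul]; rfl
  rw [hrow]
  refine (l2norm_vecMul_le _ _).trans ((mul_le_mul hfinal hWunemb (Real.sqrt_nonneg _)
    ((l2norm_nonneg _).trans hfinal)).trans ?_)
  linarith
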